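/- Let p, q, r, K², K³, η : ℝ⁴ → ℝ be smooth functions such that: (1) p, q, r satisfy the coordinate self-duality system ∂₂²p = 0, ∂₃²q = 0, ∂₂²r + ∂₂∂₃p = 0, ∂₃²r + ∂₂∂₃q = 0, ∂₃²p + ∂₂²q + 4∂₂∂₃r = 0 at every point; (2) K², K³, η satisfy the seven conformal Killing equations ∂₂K³ = 0, ∂₃K² = 0, ∂₂K² = η, ∂₃K³ = η, K²∂₂p + K³∂₃p + 2∂₀K³ = η·p, K²∂₂q + K³∂₃q − 2∂₁K² = η·q, K²∂₂r + K³∂₃r − ∂₀K² + ∂₁K³ = η·r at every point; and (3) η is nowhere zero. Then the basic conditions hold at every point: ∂₂∂₃p = 0, ∂₂∂₃q = 0, ∂₃²p + 2∂₂∂₃r = 0, and ∂₂²q + 2∂₂∂₃r = 0. (That is, the α-surface foliation determined by a null conformal Killing vector field on a neutral self-dual four-manifold is basic.) -/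

import Mathlib

noncomputable section

/-- Partial derivative `∂ᵢ f` of a function on `ℝ⁴`. -/
def pd (f : (Fin 4 → ℝ) → ℝ) (i : Fin 4) (x : Fin 4 → ℝ) : ℝ :=
  fderiv ℝ f x (Pi.single i 1)

lemma contDiff_pd {f : (Fin 4 → ℝ) → ℝ} (hf : ContDiff ℝ (⊤ : ℕ∞) f) (i : Fin 4) :
    ContDiff ℝ (⊤ : ℕ∞) (pd f i) :=
  (hf.fderiv_right (m := (⊤ : ℕ∞)) (by simp)).clm_apply contDiff_const

lemma differentiable_of_smooth {f : (Fin 4 → ℝ) → ℝ} (hf : ContDiff ℝ (⊤ : ℕ∞) f) :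
    Differentiable ℝ f :=
  hf.differentiable (by simp)

lemma pd_zero (i : Fin 4) : pd (fun _ => 0) i = fun _ => 0 := by
  funext x
  simp [pd]

lemma pd_add {f g : (Fin 4 → ℝ) → ℝ} (hf : Differentiable ℝ f) (hg : Differentiable ℝ g)
    (i : Fin 4) : pd (fun x => f x + g x) i = fun x => pd f i x + pd g i x := by
  funext x
  simp [pd, fderiv_fun_add (hf x) (hg x)]

lemma pd_mul {f g : (Fin 4 → ℝ) → ℝ} (hf : Differentiable ℝ f) (hg : Differentiable ℝ g)
    (i : Fin 4) : pd (fun x => f x * g x) i = fun x => pd f i x * g x + f x * pd g i x := by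
  funext x
  simp [pd, fderiv_fun_mul (hf x) (hg x)]
  ring

lemma pd_const_mul {f : (Fin 4 → ℝ) → ℝ} (hf : Differentiable ℝ f) (c : ℝ)
    (i : Fin 4) : pd (fun x => c * f x) i = fun x => c * pd f i x := by
  funext x
  simp [pd, fderiv_const_mul (hf x)]

lemma pd_comm {f : (Fin 4 → ℝ) → ℝ} (hf : ContDiff ℝ (⊤ : ℕ∞) f) (i j : Fin 4) :
    pd (pd f i) j = pd (pd f j) i := by
  have hd : Differentiable ℝ (fderiv ℝ f) :=
    (hf.fderiv_right (m := (⊤ : ℕ∞)) (by simp)).differentiable (by simp)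
  have key (k l : Fin 4) (x : Fin 4 → ℝ) : pd (pd f k) l x =
      fderiv ℝ (fderiv ℝ f) x (Pi.single l 1) (Pi.single k 1) := by
    simp only [pd, show pd f k = fun y => fderiv ℝ f y (Pi.single k 1) from rfl]
    rw [fderiv_clm_apply (hd x) (differentiableAt_const _)]
    simp
  funext x
  rw [key, key]
  exact (hf.contDiffAt.isSymmSndFDerivAt (by simp; exact WithTop.coe_le_coe.2 le_top)).eq _ _

lemma hasDerivAt_comp_line {f : (Fin 4 → ℝ) → ℝ} (hf : Differentiable ℝ f)
    (x : Fin 4 → ℝ) (a b s : ℝ) :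
    HasDerivAt (fun s : ℝ => f (x + s • (a • Pi.single 2 1 + b • Pi.single 3 1)))
      (a * pd f 2 (x + s • (a • Pi.single 2 1 + b • Pi.single 3 1)) +
        b * pd f 3 (x + s • (a • Pi.single 2 1 + b • Pi.single 3 1))) s := by
  have hγ : HasDerivAt
      (fun s : ℝ => x + s • (a • Pi.single 2 1 + b • Pi.single 3 1 : Fin 4 → ℝ))
      (a • Pi.single 2 1 + b • Pi.single 3 1) s := by
    simpa only [one_smul] using ((hasDerivAt_id' s).smul_const
      (a • Pi.single 2 1 + b • Pi.single 3 1 : Fin 4 → ℝ)).const_add x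
  have h := (hf (x + s • (a • Pi.single 2 1 + b • Pi.single 3 1))).hasFDerivAt.comp_hasDerivAt s hγ
  rw [map_add, map_smul, map_smul] at h
  exact h

lemma eq_of_hasDerivAt_zero {g : ℝ → ℝ} (hg : ∀ s, HasDerivAt g 0 s) (s t : ℝ) : g s = g t :=
  is_const_of_deriv_eq_zero (fun s => (hg s).differentiableAt) (fun s => (hg s).deriv) s t

/-- The coefficients of a vertical vector field `K2 ∂₂ + K3 ∂₃` that restricts to each leaf as a
homothety with factor `η`, the latter being constant along the leaves. -/
structure IsVerticalHomothety (K2 K3 η : (Fin 4 → ℝ) → ℝ) : Prop where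
  smooth_K2 : ContDiff ℝ (⊤ : ℕ∞) K2
  smooth_K3 : ContDiff ℝ (⊤ : ℕ∞) K3
  smooth_η : ContDiff ℝ (⊤ : ℕ∞) η
  pd_K2_two : pd K2 2 = η
  pd_K2_three : pd K2 3 = fun _ => 0
  pd_K3_two : pd K3 2 = fun _ => 0
  pd_K3_three : pd K3 3 = η

namespace IsVerticalHomothety

variable {K2 K3 η : (Fin 4 → ℝ) → ℝ}

lemma pd_η (h : IsVerticalHomothety K2 K3 η) {i : Fin 4} (hi : i = 2 ∨ i = 3) :
    pd η i = fun _ => 0 := by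
  rcases hi with rfl | rfl
  · rw [← h.pd_K3_three, pd_comm h.smooth_K3, h.pd_K3_two, pd_zero]
  · rw [← h.pd_K2_two, pd_comm h.smooth_K2, h.pd_K2_three, pd_zero]

lemma pd_pd_pd_K2 (h : IsVerticalHomothety K2 K3 η) (k : Fin 4) {i j : Fin 4}
    (hi : i = 2 ∨ i = 3) (hj : j = 2 ∨ j = 3) : pd (pd (pd K2 k) i) j = fun _ => 0 := by
  rw [pd_comm h.smooth_K2, pd_comm (contDiff_pd h.smooth_K2 i)]
  rcases hi with rfl | rfl
  · rw [h.pd_K2_two, h.pd_η hj, pd_zero]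
  · simp only [h.pd_K2_three, pd_zero]

lemma pd_pd_pd_K3 (h : IsVerticalHomothety K2 K3 η) (k : Fin 4) {i j : Fin 4}
    (hi : i = 2 ∨ i = 3) (hj : j = 2 ∨ j = 3) : pd (pd (pd K3 k) i) j = fun _ => 0 := by
  rw [pd_comm h.smooth_K3, pd_comm (contDiff_pd h.smooth_K3 i)]
  rcases hi with rfl | rfl
  · simp only [h.pd_K3_two, pd_zero]
  · rw [h.pd_K3_three, h.pd_η hj, pd_zero]

/-- A vertical derivative lowers the degree of homogeneity by one. -/
lemma lower_degree (h : IsVerticalHomothety K2 K3 η) {f A : (Fin 4 → ℝ) → ℝ}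
    (hf : ContDiff ℝ (⊤ : ℕ∞) f) (hA : Differentiable ℝ A) {c : ℝ}
    (heq : ∀ x, K2 x * pd f 2 x + K3 x * pd f 3 x + A x = c * (η x * f x))
    {i : Fin 4} (hi : i = 2 ∨ i = 3) (x : Fin 4 → ℝ) :
    K2 x * pd (pd f i) 2 x + K3 x * pd (pd f i) 3 x + pd A i x =
      (c - 1) * (η x * pd f i x) := by
  have d2 := differentiable_of_smooth h.smooth_K2
  have d3 := differentiable_of_smooth h.smooth_K3
  have dη := differentiable_of_smooth h.smooth_η
  have df := differentiable_of_smooth hf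
  have df2 := differentiable_of_smooth (contDiff_pd hf 2)
  have df3 := differentiable_of_smooth (contDiff_pd hf 3)
  have e := congrFun (congrArg (pd · i) (funext heq)) x
  rw [pd_add ((d2.fun_mul df2).fun_add (d3.fun_mul df3)) hA,
    pd_add (d2.fun_mul df2) (d3.fun_mul df3),
    pd_mul d2 df2, pd_mul d3 df3, pd_const_mul (dη.fun_mul df), pd_mul dη df, h.pd_η hi,
    pd_comm hf 2 i, pd_comm hf 3 i] at e
  rcases hi with rfl | rfl
  · simp only [h.pd_K2_two, h.pd_K3_two] at e
    linear_combination e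
  · simp only [h.pd_K2_three, h.pd_K3_three] at e
    linear_combination e

/-- A smooth function that is homogeneous of degree `-1` on the leaves vanishes. -/
lemma eq_zero_of_degree_neg_one (h : IsVerticalHomothety K2 K3 η) (hη0 : ∀ x, η x ≠ 0)
    {f : (Fin 4 → ℝ) → ℝ} (hf : Differentiable ℝ f)
    (heq : ∀ x, K2 x * pd f 2 x + K3 x * pd f 3 x = -(η x * f x)) (x : Fin 4 → ℝ) :
    f x = 0 := by
  set a := K2 x / η x with ha
  set b := K3 x / η x with hb
  have ha' : a * η x = K2 x := div_mul_cancel₀ _ (hη0 x)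
  have hb' : b * η x = K3 x := div_mul_cancel₀ _ (hη0 x)
  let γ : ℝ → Fin 4 → ℝ := fun s => x + s • (a • Pi.single 2 1 + b • Pi.single 3 1)
  have γ0 : γ 0 = x := by simp [γ]
  have der {g : (Fin 4 → ℝ) → ℝ} (hg : Differentiable ℝ g) (s : ℝ) :
      HasDerivAt (fun s => g (γ s)) (a * pd g 2 (γ s) + b * pd g 3 (γ s)) s :=
    hasDerivAt_comp_line hg x a b s
  have hη (s : ℝ) : η (γ s) = η x := by
    have := eq_of_hasDerivAt_zero (g := fun s => η (γ s)) (fun s => by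
      simpa [h.pd_η] using der (differentiable_of_smooth h.smooth_η) s) s 0
    simpa [γ0] using this
  have h2 (s : ℝ) : K2 (γ s) = (1 + s) * K2 x := by
    have := eq_of_hasDerivAt_zero (g := fun s => K2 (γ s) - s * K2 x) (fun s => by
      refine ((der (differentiable_of_smooth h.smooth_K2) s).sub
        ((hasDerivAt_id s).mul_const (K2 x))).congr_deriv ?_
      simp [h.pd_K2_two, h.pd_K2_three, hη, ha']) s 0
    simp only [γ0] at this
    linear_combination this
  have h3 (s : ℝ) : K3 (γ s) = (1 + s) * K3 x := by
    have := eq_of_hasDerivAt_zero (g := fun s => K3 (γ s) - s * K3 x) (fun s => by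
      refine ((der (differentiable_of_smooth h.smooth_K3) s).sub
        ((hasDerivAt_id s).mul_const (K3 x))).congr_deriv ?_
      simp [h.pd_K3_two, h.pd_K3_three, hη, hb']) s 0
    simp only [γ0] at this
    linear_combination this
  have := eq_of_hasDerivAt_zero (g := fun s => (1 + s) * f (γ s)) (fun s => by
    refine (((hasDerivAt_id s).const_add 1).mul (der hf s)).congr_deriv ?_
    have e := heq (γ s)
    rw [h2, h3, hη, ← ha', ← hb'] at e
    apply mul_left_cancel₀ (hη0 x)
    simp only [id]
    linear_combination e) 0 (-1)
  simpa [γ0] using this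

lemma pd_pd_eq_zero (h : IsVerticalHomothety K2 K3 η) (hη0 : ∀ x, η x ≠ 0)
    {f A : (Fin 4 → ℝ) → ℝ} (hf : ContDiff ℝ (⊤ : ℕ∞) f) (hA : ContDiff ℝ (⊤ : ℕ∞) A)
    (heq : ∀ x, K2 x * pd f 2 x + K3 x * pd f 3 x + A x = η x * f x)
    {i j : Fin 4} (hi : i = 2 ∨ i = 3) (hj : j = 2 ∨ j = 3)
    (hAij : pd (pd A i) j = fun _ => 0) (x : Fin 4 → ℝ) : pd (pd f i) j x = 0 := by
  have e1 := h.lower_degree hf (differentiable_of_smooth hA) (c := 1) (by simpa using heq) hi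
  have e2 := h.lower_degree (contDiff_pd hf i)
    (differentiable_of_smooth (contDiff_pd hA i)) e1 hj
  refine h.eq_zero_of_degree_neg_one hη0
    (differentiable_of_smooth (contDiff_pd (contDiff_pd hf i) j)) (fun y => ?_) x
  have := e2 y
  rw [hAij] at this
  linear_combination this

end IsVerticalHomothety

/-- The α-surface foliation determined by a null conformal Killing vector field on a
neutral self-dual four-manifold is basic: if `p,q,r` satisfy the coordinate self-duality
system, `K²,K³,η` satisfy the seven conformal Killing equations, and `η` is nowhere zero,
then the basic conditions `∂₂∂₃p = 0`, `∂₂∂₃q = 0`, `∂₃²p + 2∂₂∂₃r = 0`,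
`∂₂²q + 2∂₂∂₃r = 0` hold at every point. -/
theorem stmt16 (p q r K2 K3 η : (Fin 4 → ℝ) → ℝ)
    (hp : ContDiff ℝ (⊤ : ℕ∞) p) (hq : ContDiff ℝ (⊤ : ℕ∞) q) (hr : ContDiff ℝ (⊤ : ℕ∞) r)
    (hK2 : ContDiff ℝ (⊤ : ℕ∞) K2) (hK3 : ContDiff ℝ (⊤ : ℕ∞) K3) (hη : ContDiff ℝ (⊤ : ℕ∞) η)
    (hsd : ∀ x : Fin 4 → ℝ,
      pd (pd p 2) 2 x = 0 ∧
      pd (pd q 3) 3 x = 0 ∧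
      pd (pd r 2) 2 x + pd (pd p 3) 2 x = 0 ∧
      pd (pd r 3) 3 x + pd (pd q 3) 2 x = 0 ∧
      pd (pd p 3) 3 x + pd (pd q 2) 2 x + 4 * pd (pd r 3) 2 x = 0)
    (hkill : ∀ x : Fin 4 → ℝ,
      pd K3 2 x = 0 ∧
      pd K2 3 x = 0 ∧
      pd K2 2 x = η x ∧
      pd K3 3 x = η x ∧
      K2 x * pd p 2 x + K3 x * pd p 3 x + 2 * pd K3 0 x = η x * p x ∧
      K2 x * pd q 2 x + K3 x * pd q 3 x - 2 * pd K2 1 x = η x * q x ∧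
      K2 x * pd r 2 x + K3 x * pd r 3 x - pd K2 0 x + pd K3 1 x = η x * r x)
    (hη0 : ∀ x : Fin 4 → ℝ, η x ≠ 0) :
    ∀ x : Fin 4 → ℝ,
      pd (pd p 3) 2 x = 0 ∧
      pd (pd q 3) 2 x = 0 ∧
      pd (pd p 3) 3 x + 2 * pd (pd r 3) 2 x = 0 ∧
      pd (pd q 2) 2 x + 2 * pd (pd r 3) 2 x = 0 := by
  have h : IsVerticalHomothety K2 K3 η :=
    ⟨hK2, hK3, hη, funext fun x => (hkill x).2.2.1, funext fun x => (hkill x).2.1,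
      funext fun x => (hkill x).1, funext fun x => (hkill x).2.2.2.1⟩
  have P {i j : Fin 4} (hi : i = 2 ∨ i = 3) (hj : j = 2 ∨ j = 3) (x) : pd (pd p i) j x = 0 := by
    have s := contDiff_pd hK3 0
    refine h.pd_pd_eq_zero hη0 hp (A := fun x => 2 * pd K3 0 x) (contDiff_const.mul s)
      (fun x => (hkill x).2.2.2.2.1) hi hj ?_ x
    rw [pd_const_mul (differentiable_of_smooth s),
      pd_const_mul (differentiable_of_smooth (contDiff_pd s i)), h.pd_pd_pd_K3 0 hi hj]
    simp
  have Q {i j : Fin 4} (hi : i = 2 ∨ i = 3) (hj : j = 2 ∨ j = 3) (x) : pd (pd q i) j x = 0 := by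
    have s := contDiff_pd hK2 1
    refine h.pd_pd_eq_zero hη0 hq (A := fun x => -2 * pd K2 1 x) (contDiff_const.mul s)
      (fun x => by linear_combination (hkill x).2.2.2.2.2.1) hi hj ?_ x
    rw [pd_const_mul (differentiable_of_smooth s),
      pd_const_mul (differentiable_of_smooth (contDiff_pd s i)), h.pd_pd_pd_K2 1 hi hj]
    simp
  have R {i j : Fin 4} (hi : i = 2 ∨ i = 3) (hj : j = 2 ∨ j = 3) (x) : pd (pd r i) j x = 0 := by
    have s := contDiff_pd hK2 0
    have t := contDiff_pd hK3 1
    have si := contDiff_pd s i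
    have ti := contDiff_pd t i
    refine h.pd_pd_eq_zero hη0 hr (A := fun x => -1 * pd K2 0 x + pd K3 1 x)
      ((contDiff_const.mul s).add t)
      (fun x => by linear_combination (hkill x).2.2.2.2.2.2) hi hj ?_ x
    rw [pd_add ((differentiable_of_smooth s).const_mul _) (differentiable_of_smooth t),
      pd_const_mul (differentiable_of_smooth s),
      pd_add ((differentiable_of_smooth si).const_mul _) (differentiable_of_smooth ti),
      pd_const_mul (differentiable_of_smooth si), h.pd_pd_pd_K2 0 hi hj, h.pd_pd_pd_K3 1 hi hj]
    simp
  intro x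
  simp [P, Q, R]
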